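/- Let C : S^{N-1} → ℝ be Lipschitz. Then d_{HH}(𝒞^γ, 𝒞^0) → 0 as γ → 0⁺, where d_{HH} is the Hausdorff distance between compact collections of nonempty compact subsets of ℝ^N, the collections themselves being measured with the Hausdorff distance d_H. -/

import Mathlib

open MeasureTheory Metric Set TopologicalSpace Filter
open scoped RealInnerProductSpace NNReal ENNReal

noncomputable section

abbrev Euc (N : ℕ) := EuclideanSpace ℝ (Fin N)

/-- The outreach (support) function of a set. -/
def outreach {N : ℕ} (B : Set (Euc N)) (u : Euc N) : ℝ :=
  sSup ((fun b => ⟪b, u⟫) '' B)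

/-- The half-space `Π⁻(u,b)`. -/
def halfSpace {N : ℕ} (u : Euc N) (b : ℝ) : Set (Euc N) := {x | ⟪u, x⟫ ≤ b}

/-- The uniform probability measure on the unit sphere. -/
def sphereMeasure (N : ℕ) : Measure (Metric.sphere (0 : Euc N) 1) :=
  (((volume : Measure (Euc N)).toSphere) Set.univ)⁻¹ • ((volume : Measure (Euc N)).toSphere)

/-- The sup-norm of a function restricted to the unit sphere. -/
def supNormSphere {N : ℕ} (f : Euc N → ℝ) : ℝ :=
  ⨆ x : Metric.sphere (0 : Euc N) 1, |f x|

/-- The dispersion of a set of directions. -/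
def dispersion {N : ℕ} (S : Set (Euc N)) : ℝ :=
  ⨆ u : Metric.sphere (0 : Euc N) 1, ⨅ v : S, ‖(u : Euc N) - (v : Euc N)‖

/-- `ε`-accurate quadrature on the unit sphere. -/
def IsAccurateQuadrature {N : ℕ} {ι : Type*} [Fintype ι]
    (u : ι → Euc N) (w : ι → ℝ) (ε : ℝ) : Prop :=
  (∀ i, u i ∈ Metric.sphere (0 : Euc N) 1) ∧ (∀ i, 0 ≤ w i) ∧
  ∀ (L : ℝ≥0) (f : Euc N → ℝ), LipschitzOnWith L f (Metric.sphere (0 : Euc N) 1) →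
    |(∫ x : Metric.sphere (0 : Euc N) 1, f x ∂(sphereMeasure N)) - ∑ i, w i * f (u i)|
      ≤ ε * (L + supNormSphere f)

/-- Halved mean width. -/
def meanHalfWidth {N : ℕ} (B : Set (Euc N)) : ℝ :=
  ∫ u : Metric.sphere (0 : Euc N) 1, outreach B (u : Euc N) ∂(sphereMeasure N)

/-- Feasible solutions of the continuous problem. -/
def CInf {N : ℕ} (C : Euc N → ℝ) : Set (Set (Euc N)) :=
  {B | B.Nonempty ∧ Convex ℝ B ∧ IsCompact B ∧
    ∀ u ∈ Metric.sphere (0 : Euc N) 1, C u ≤ outreach B u}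

/-- Optimal value of the continuous problem. -/
def VCP {N : ℕ} (C : Euc N → ℝ) : ℝ := sInf (meanHalfWidth '' CInf C)

/-- `γ`-near optimal solutions of the continuous problem. -/
def CGamma {N : ℕ} (C : Euc N → ℝ) (γ : ℝ) : Set (Set (Euc N)) :=
  {B ∈ CInf C | meanHalfWidth B - VCP C ≤ γ}

/-- Feasible solutions of the discrete problem with node set `S`. -/
def DInf {N : ℕ} (C : Euc N → ℝ) (S : Set (Euc N)) : Set (Set (Euc N)) :=
  {B | B.Nonempty ∧ Convex ℝ B ∧ IsCompact B ∧ ∀ u ∈ S, C u ≤ outreach B u}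

/-- Discrete objective. -/
def quadSum {N : ℕ} {ι : Type*} [Fintype ι] (u : ι → Euc N) (w : ι → ℝ)
    (B : Set (Euc N)) : ℝ :=
  ∑ i, w i * outreach B (u i)

/-- Optimal value of the discrete problem. -/
def VDP {N : ℕ} {ι : Type*} [Fintype ι] (u : ι → Euc N) (w : ι → ℝ) (C : Euc N → ℝ) : ℝ :=
  sInf (quadSum u w '' DInf C (Set.range u))

/-- `γ`-near optimal solutions of the discrete problem. -/
def DGamma {N : ℕ} {ι : Type*} [Fintype ι] (u : ι → Euc N) (w : ι → ℝ) (C : Euc N → ℝ)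
    (γ : ℝ) : Set (Set (Euc N)) :=
  {B ∈ DInf C (Set.range u) | quadSum u w B - VDP u w C ≤ γ}

lemma aux_nontrivial {N : ℕ} (hN : N ≠ 0) : Nontrivial (Euc N) := by
  haveI : Nonempty (Fin N) := ⟨⟨0, Nat.pos_of_ne_zero hN⟩⟩
  infer_instance

lemma aux_prob {N : ℕ} [Nontrivial (Euc N)] : IsProbabilityMeasure (sphereMeasure N) := by
  constructor
  rw [sphereMeasure, Measure.smul_apply, smul_eq_mul]
  apply ENNReal.inv_mul_cancel
  · rw [Ne, Measure.measure_univ_eq_zero]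
    exact Measure.toSphere_ne_zero _
  · exact measure_ne_top _ _

lemma aux_openpos {N : ℕ} : (sphereMeasure N).IsOpenPosMeasure := by
  constructor
  intro U hU hne
  rw [sphereMeasure, Measure.smul_apply, smul_eq_mul]
  apply mul_ne_zero
  · exact ENNReal.inv_ne_zero.2 (measure_ne_top _ _)
  · exact hU.measure_ne_zero _ hne

lemma aux_bdd {N : ℕ} {B : Set (Euc N)} (hB : IsCompact B) (u : Euc N) :
    BddAbove ((fun b => ⟪b, u⟫) '' B) :=
  (hB.image (by fun_prop)).bddAbove

lemma le_outreach {N : ℕ} {B : Set (Euc N)} (hB : IsCompact B) {b : Euc N} (hb : b ∈ B)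
    (u : Euc N) : ⟪b, u⟫ ≤ outreach B u :=
  le_csSup (aux_bdd hB u) (mem_image_of_mem _ hb)

lemma outreach_le {N : ℕ} {B : Set (Euc N)} (hB : B.Nonempty) {u : Euc N} {c : ℝ}
    (h : ∀ b ∈ B, ⟪b, u⟫ ≤ c) : outreach B u ≤ c := by
  apply csSup_le (hB.image _)
  rintro _ ⟨b, hb, rfl⟩
  exact h b hb

lemma outreach_cont {N : ℕ} {B : Set (Euc N)} (hB : IsCompact B) :
    Continuous (outreach B) := by
  apply hB.continuous_sSup (f := fun u b => ⟪b, u⟫)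
  fun_prop

lemma exists_near {N : ℕ} (K L : NonemptyCompacts (Euc N)) {b : Euc N} (hb : b ∈ K) {r : ℝ}
    (hr : dist K L < r) : ∃ y ∈ L, dist b y < r := by
  rw [NonemptyCompacts.dist_eq] at hr
  exact exists_dist_lt_of_hausdorffDist_lt hb hr
    (hausdorffEDist_ne_top_of_nonempty_of_bounded K.nonempty L.nonempty
      K.isCompact.isBounded L.isCompact.isBounded)

lemma outreach_le_add {N : ℕ} (K L : NonemptyCompacts (Euc N)) (u : Euc N) (hu : ‖u‖ = 1) :
    outreach (K : Set (Euc N)) u ≤ outreach (L : Set (Euc N)) u + dist K L := by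
  apply outreach_le K.nonempty
  intro b hb
  apply le_of_forall_pos_le_add
  intro ε hε
  obtain ⟨y, hy, hd⟩ := exists_near K L hb (r := dist K L + ε) (by linarith)
  have h1 := le_outreach L.isCompact hy u
  have h2 : ⟪b - y, u⟫ ≤ ‖b - y‖ * ‖u‖ := real_inner_le_norm _ _
  rw [inner_sub_left, hu, mul_one, ← dist_eq_norm] at h2
  linarith

lemma outreach_lip {N : ℕ} (u : Euc N) (hu : ‖u‖ = 1) :
    LipschitzWith 1 (fun K : NonemptyCompacts (Euc N) => outreach (K : Set (Euc N)) u) :=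
  LipschitzWith.of_le_add fun K L => outreach_le_add K L u hu

lemma sphere_integrable {N : ℕ} [Nontrivial (Euc N)]
    {f : Metric.sphere (0 : Euc N) 1 → ℝ} (hf : Continuous f) :
    Integrable f (sphereMeasure N) := by
  have := aux_prob (N := N)
  exact hf.integrable_of_hasCompactSupport (HasCompactSupport.of_compactSpace f)

lemma mean_lip {N : ℕ} [Nontrivial (Euc N)] :
    LipschitzWith 1 (fun K : NonemptyCompacts (Euc N) => meanHalfWidth (K : Set (Euc N))) := by
  have := aux_prob (N := N)
  apply LipschitzWith.of_le_add
  intro K L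
  have hK := sphere_integrable ((outreach_cont K.isCompact).comp continuous_subtype_val)
  have hL := sphere_integrable ((outreach_cont L.isCompact).comp continuous_subtype_val)
  have h := integral_mono hK (hL.add (integrable_const (dist K L)))
    (fun u => outreach_le_add K L u (by simpa using u.2))
  rw [integral_add' hL (integrable_const _)] at h
  simpa [meanHalfWidth] using h

lemma pos_part_bound {N : ℕ} [Nontrivial (Euc N)] :
    ∃ c > 0, ∀ b : Euc N,
      c * ‖b‖ ≤ ∫ u : Metric.sphere (0 : Euc N) 1, max ⟪b, (u : Euc N)⟫ 0 ∂(sphereMeasure N) := by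
  have := aux_prob (N := N)
  have := aux_openpos (N := N)
  set F : Euc N → ℝ := fun b =>
    ∫ u : Metric.sphere (0 : Euc N) 1, max ⟪b, (u : Euc N)⟫ 0 ∂(sphereMeasure N) with hF
  have hint : ∀ b : Euc N, Integrable (fun u : Metric.sphere (0 : Euc N) 1 =>
      max ⟪b, (u : Euc N)⟫ 0) (sphereMeasure N) := fun b => sphere_integrable (by fun_prop)
  have hlip : LipschitzWith 1 F := by
    apply LipschitzWith.of_le_add
    intro a b
    have h := integral_mono (hint a) ((hint b).add (integrable_const (dist a b))) (fun u => by
      have h2 : ⟪a - b, (u : Euc N)⟫ ≤ ‖a - b‖ * ‖(u : Euc N)‖ := real_inner_le_norm _ _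
      have hu : ‖(u : Euc N)‖ = 1 := by simpa using u.2
      rw [inner_sub_left, hu, mul_one, ← dist_eq_norm] at h2
      have hd : 0 ≤ dist a b := dist_nonneg
      have h3 := le_max_left ⟪b, (u : Euc N)⟫ 0
      have h4 := le_max_right ⟪b, (u : Euc N)⟫ 0
      show max ⟪a, (u : Euc N)⟫ 0 ≤ max ⟪b, (u : Euc N)⟫ 0 + dist a b
      apply max_le <;> linarith)
    rw [integral_add' (hint b) (integrable_const _)] at h
    simpa using h
  have hpos : ∀ e ∈ Metric.sphere (0 : Euc N) 1, 0 < F e := by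
    intro e he
    apply Continuous.integral_pos_of_hasCompactSupport_nonneg_nonzero (x := ⟨e, he⟩)
    · fun_prop
    · exact HasCompactSupport.of_compactSpace _
    · intro u; exact le_max_right _ _
    · have : ‖e‖ = 1 := by simpa using he
      simp [this]
  obtain ⟨e, he, hmin⟩ := (isCompact_sphere (0 : Euc N) 1).exists_isMinOn
    (NormedSpace.sphere_nonempty.2 zero_le_one) hlip.continuous.continuousOn
  refine ⟨F e, hpos e he, fun b => ?_⟩
  by_cases hb : b = 0
  · subst hb; simp
  have hb' : 0 < ‖b‖ := norm_pos_iff.2 hb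
  have h1 : F e ≤ F (‖b‖⁻¹ • b) := hmin (by simp [norm_smul, hb])
  have h2 : F (‖b‖⁻¹ • b) = ‖b‖⁻¹ * F b := by
    simp only [hF]
    rw [← integral_const_mul]
    congr 1
    ext u
    rw [real_inner_smul_left, mul_max_of_nonneg _ _ (inv_nonneg.2 hb'.le), mul_zero]
  rw [h2, inv_mul_eq_div, le_div_iff₀ hb'] at h1
  exact h1

lemma C_bound {N : ℕ} {C : Euc N → ℝ} {LC : ℝ≥0}
    (hC : LipschitzOnWith LC C (Metric.sphere (0 : Euc N) 1)) :
    ∃ M : ℝ, 0 ≤ M ∧ ∀ u ∈ Metric.sphere (0 : Euc N) 1, |C u| ≤ M := by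
  obtain ⟨M, hM⟩ := (isCompact_sphere (0 : Euc N) 1).exists_bound_of_continuousOn hC.continuousOn
  exact ⟨max M 0, le_max_right _ _, fun u hu => (hM u hu).trans (le_max_left _ _)⟩

lemma mean_lower {N : ℕ} [Nontrivial (Euc N)] {C : Euc N → ℝ} {M c : ℝ} (hM0 : 0 ≤ M)
    (hM : ∀ u ∈ Metric.sphere (0 : Euc N) 1, |C u| ≤ M)
    (hc : ∀ b : Euc N,
      c * ‖b‖ ≤ ∫ u : Metric.sphere (0 : Euc N) 1, max ⟪b, (u : Euc N)⟫ 0 ∂(sphereMeasure N))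
    {B : Set (Euc N)} (hB : B ∈ CInf C) {b : Euc N} (hb : b ∈ B) :
    c * ‖b‖ ≤ meanHalfWidth B + M := by
  have := aux_prob (N := N)
  obtain ⟨-, -, hcomp, hfeas⟩ := hB
  have hint := sphere_integrable ((outreach_cont hcomp).comp continuous_subtype_val)
  have h := integral_mono (f := fun u : Metric.sphere (0 : Euc N) 1 => max ⟪b, (u : Euc N)⟫ 0)
    (sphere_integrable (by fun_prop)) (hint.add (integrable_const M)) (fun u => by
      have h1 := le_outreach hcomp hb (u : Euc N)
      have h2 := hfeas u u.2
      have h3 := (abs_le.1 (hM u u.2)).1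
      show max ⟪b, (u : Euc N)⟫ 0 ≤ outreach B u + M
      apply max_le <;> linarith)
  rw [integral_add' hint (integrable_const _)] at h
  refine (hc b).trans ?_
  simpa [meanHalfWidth] using h

lemma isClosed_convex {N : ℕ} :
    IsClosed {K : NonemptyCompacts (Euc N) | Convex ℝ (K : Set (Euc N))} := by
  rw [← isSeqClosed_iff_isClosed]
  intro s K hs hlim x hx y hy a b ha hb hab
  rw [← K.isCompact.isClosed.closure_eq, Metric.mem_closure_iff]
  intro ε hε
  obtain ⟨n, hn⟩ := (Metric.tendsto_nhds.1 hlim (ε / 2) (by positivity)).exists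
  obtain ⟨x', hx', hxd⟩ := exists_near K (s n) hx (by rwa [dist_comm])
  obtain ⟨y', hy', hyd⟩ := exists_near K (s n) hy (by rwa [dist_comm])
  obtain ⟨z, hz, hzd⟩ := exists_near (s n) K (hs n hx' hy' ha hb hab) hn
  refine ⟨z, hz, ?_⟩
  have h1 : dist (a • x + b • y) (a • x' + b • y') ≤ ε / 2 := by
    calc dist (a • x + b • y) (a • x' + b • y')
        ≤ dist (a • x) (a • x') + dist (b • y) (b • y') := dist_add_add_le _ _ _ _
      _ = a * dist x x' + b * dist y y' := by
          rw [dist_smul₀, dist_smul₀, Real.norm_of_nonneg ha, Real.norm_of_nonneg hb]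
      _ ≤ a * (ε / 2) + b * (ε / 2) := by gcongr
      _ = ε / 2 := by rw [← add_mul, hab, one_mul]
  linarith [dist_triangle (a • x + b • y) (a • x' + b • y') z]

lemma isClosed_feas {N : ℕ} (C : Euc N → ℝ) :
    IsClosed {K : NonemptyCompacts (Euc N) | (K : Set (Euc N)) ∈ CInf C} := by
  have : {K : NonemptyCompacts (Euc N) | (K : Set (Euc N)) ∈ CInf C} =
      {K : NonemptyCompacts (Euc N) | Convex ℝ (K : Set (Euc N))} ∩
      ⋂ u ∈ Metric.sphere (0 : Euc N) 1,
        {K : NonemptyCompacts (Euc N) | C u ≤ outreach (K : Set (Euc N)) u} := by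
    ext K
    simp only [CInf, mem_setOf_eq, mem_inter_iff, mem_iInter, K.nonempty, K.isCompact, true_and]
  rw [this]
  refine isClosed_convex.inter (isClosed_biInter fun u hu => ?_)
  exact isClosed_le continuous_const (outreach_lip u (by simpa using hu)).continuous

lemma isCompact_CGamma {N : ℕ} [Nontrivial (Euc N)] (C : Euc N → ℝ) {LC : ℝ≥0}
    (hC : LipschitzOnWith LC C (Metric.sphere (0 : Euc N) 1)) (γ : ℝ) :
    IsCompact {K : NonemptyCompacts (Euc N) | (K : Set (Euc N)) ∈ CGamma C γ} := by
  obtain ⟨M, hM0, hM⟩ := C_bound hC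
  obtain ⟨c, hc0, hc⟩ := pos_part_bound (N := N)
  apply (NonemptyCompacts.isCompact_subsets_of_isCompact
    (isCompact_closedBall (0 : Euc N) ((γ + VCP C + M) / c))).of_isClosed_subset
  · exact (isClosed_feas C).inter
      (isClosed_le (mean_lip.continuous.sub continuous_const) continuous_const)
  · rintro K ⟨hK, hKm⟩ b hb
    have h := mean_lower hM0 hM hc hK hb
    rw [mem_closedBall_zero_iff, le_div_iff₀ hc0]
    linarith

lemma VCP_facts {N : ℕ} [Nontrivial (Euc N)] (C : Euc N → ℝ) {LC : ℝ≥0}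
    (hC : LipschitzOnWith LC C (Metric.sphere (0 : Euc N) 1)) :
    (CInf C).Nonempty ∧ ∀ B ∈ CInf C, VCP C ≤ meanHalfWidth B := by
  obtain ⟨M, hM0, hM⟩ := C_bound hC
  obtain ⟨c, hc0, hc⟩ := pos_part_bound (N := N)
  constructor
  · refine ⟨closedBall 0 M, ⟨0, by simpa using hM0⟩, convex_closedBall _ _,
      isCompact_closedBall _ _, fun u hu => ?_⟩
    have hu' : ‖u‖ = 1 := by simpa using hu
    have h := le_outreach (isCompact_closedBall (0 : Euc N) M) (b := M • u)
      (by simp [norm_smul, hu', abs_of_nonneg hM0]) u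
    rw [real_inner_smul_left, real_inner_self_eq_norm_sq, hu'] at h
    linarith [(abs_le.1 (hM u hu)).2]
  · intro B hB
    refine csInf_le ⟨-M, ?_⟩ (mem_image_of_mem _ hB)
    rintro _ ⟨B, hB, rfl⟩
    obtain ⟨b, hb⟩ := hB.1
    have h := mean_lower hM0 hM hc hB hb
    have : 0 ≤ c * ‖b‖ := by positivity
    linarith

lemma exists_opt {N : ℕ} [Nontrivial (Euc N)] (C : Euc N → ℝ) {LC : ℝ≥0}
    (hC : LipschitzOnWith LC C (Metric.sphere (0 : Euc N) 1)) :
    {K : NonemptyCompacts (Euc N) | (K : Set (Euc N)) ∈ CGamma C 0}.Nonempty := by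
  obtain ⟨hne, hle⟩ := VCP_facts C hC
  have key : ∀ ε > 0, ∃ B : NonemptyCompacts (Euc N), (B : Set (Euc N)) ∈ CInf C ∧
      meanHalfWidth (B : Set (Euc N)) < VCP C + ε := by
    intro ε hε
    obtain ⟨_, ⟨B, hB, rfl⟩, hlt⟩ := exists_lt_of_csInf_lt (hne.image meanHalfWidth)
      (show VCP C < VCP C + ε by linarith)
    exact ⟨⟨⟨B, hB.2.2.1⟩, hB.1⟩, hB, hlt⟩
  obtain ⟨B1, hB1, hB1m⟩ := key 1 one_pos
  obtain ⟨K, hK, hmin⟩ := (isCompact_CGamma C hC 1).exists_isMinOn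
    ⟨B1, hB1, by linarith⟩ mean_lip.continuous.continuousOn
  refine ⟨K, hK.1, ?_⟩
  rw [sub_nonpos]
  apply le_of_forall_pos_le_add
  intro ε hε
  obtain ⟨B, hB, hBm⟩ := key (min ε 1) (lt_min hε one_pos)
  have h1 := min_le_left ε 1
  have h2 := min_le_right ε 1
  have h3 : meanHalfWidth (K : Set (Euc N)) ≤ meanHalfWidth (B : Set (Euc N)) :=
    hmin (show (B : Set (Euc N)) ∈ CGamma C 1 from ⟨hB, by linarith⟩)
  linarith

/-- for Lipschitz `C`, the Hausdorff distance (in the space of nonempty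
compact subsets of `ℝ^N` with the Hausdorff metric) between `𝒞^γ` and `𝒞^0` tends to
`0` as `γ → 0⁺`. -/
theorem CGamma_tendsto_COpt {N : ℕ}
    (C : Euc N → ℝ) (LC : ℝ≥0) (hC : LipschitzOnWith LC C (Metric.sphere (0 : Euc N) 1)) :
    Filter.Tendsto
      (fun γ : ℝ => Metric.hausdorffDist
        {K : NonemptyCompacts (Euc N) | (K : Set (Euc N)) ∈ CGamma C γ}
        {K : NonemptyCompacts (Euc N) | (K : Set (Euc N)) ∈ CGamma C 0})
      (nhdsWithin 0 (Set.Ioi 0)) (nhds 0) := by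
  rcases eq_or_ne N 0 with rfl | hN
  · have : ∀ S T : Set (NonemptyCompacts (Euc 0)), Metric.hausdorffDist S T = 0 := by
      intro S T
      have hsub : Subsingleton (NonemptyCompacts (Euc 0)) := by
        refine ⟨fun K L => SetLike.coe_injective ?_⟩
        rw [Subsingleton.eq_univ_of_nonempty K.nonempty, Subsingleton.eq_univ_of_nonempty L.nonempty]
      rcases S.eq_empty_or_nonempty with rfl | hS
      · simp
      rcases T.eq_empty_or_nonempty with rfl | hT
      · simp
      rw [Subsingleton.eq_univ_of_nonempty hS, Subsingleton.eq_univ_of_nonempty hT]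
      simp
    simp only [this]
    exact tendsto_const_nhds
  have := aux_nontrivial hN
  set A := {K : NonemptyCompacts (Euc N) | (K : Set (Euc N)) ∈ CGamma C 0} with hA
  rw [Metric.tendsto_nhds]
  intro ε hε
  -- the near optimal sets lie close to the optimal ones
  have key : ∃ δ > 0, ∀ γ < δ, ∀ K : NonemptyCompacts (Euc N),
      (K : Set (Euc N)) ∈ CGamma C γ → K ∈ Metric.thickening (ε / 2) A := by
    have hcomp := (isCompact_CGamma C hC 1).diff
      (Metric.isOpen_thickening (δ := ε / 2) (E := A))
    rcases Set.eq_empty_or_nonempty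
      ({K : NonemptyCompacts (Euc N) | (K : Set (Euc N)) ∈ CGamma C 1} \
        Metric.thickening (ε / 2) A) with he | hne
    · refine ⟨1, one_pos, fun γ hγ K hK => ?_⟩
      by_contra hcon
      have : K ∈ (∅ : Set (NonemptyCompacts (Euc N))) := by
        rw [← he]
        exact ⟨⟨hK.1, hK.2.trans hγ.le⟩, hcon⟩
      exact this
    · obtain ⟨K0, hK0, hmin⟩ := hcomp.exists_isMinOn hne mean_lip.continuous.continuousOn
      have hpos : 0 < meanHalfWidth (K0 : Set (Euc N)) - VCP C := by
        by_contra hcon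
        apply hK0.2
        apply Metric.self_subset_thickening (by positivity)
        exact ⟨hK0.1.1, not_lt.1 hcon⟩
      refine ⟨min 1 (meanHalfWidth (K0 : Set (Euc N)) - VCP C), lt_min one_pos hpos,
        fun γ hγ K hK => ?_⟩
      by_contra hcon
      have h1 := lt_of_lt_of_le hγ (min_le_left _ _)
      have h2 := lt_of_lt_of_le hγ (min_le_right _ _)
      have h3 : meanHalfWidth (K0 : Set (Euc N)) ≤ meanHalfWidth (K : Set (Euc N)) :=
        hmin ⟨⟨hK.1, hK.2.trans h1.le⟩, hcon⟩
      have h4 := hK.2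
      linarith
  obtain ⟨δ, hδ, hkey⟩ := key
  filter_upwards [Ioo_mem_nhdsGT hδ] with γ hγ
  rw [Real.dist_0_eq_abs, abs_of_nonneg Metric.hausdorffDist_nonneg]
  refine lt_of_le_of_lt (Metric.hausdorffDist_le_of_mem_dist (r := ε / 2) (by positivity) ?_ ?_)
    (by linarith)
  · intro K hK
    obtain ⟨L, hL, hd⟩ := Metric.mem_thickening_iff.1 (hkey γ hγ.2 K hK)
    exact ⟨L, hL, hd.le⟩
  · intro K hK
    exact ⟨K, ⟨hK.1, hK.2.trans hγ.1.le⟩, by simp; positivity⟩
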